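/- There exists a constant c > 0 such that for every integer k ≥ 1 and every finite k-regular simple graph G, χ_d(G) ≤ χ(G) + c·ln k + 1. -/

import Mathlib

open SimpleGraph Set

def IsDynamicColoring {V : Type*} (G : SimpleGraph V) {n : ℕ} (c : V → Fin n) : Prop :=
  (∀ ⦃u v⦄, G.Adj u v → c u ≠ c v) ∧
  ∀ v : V, 2 ≤ (G.neighborSet v).ncard →
    ∃ u w, u ∈ G.neighborSet v ∧ w ∈ G.neighborSet v ∧ c u ≠ c w

def DynColorable {V : Type*} (G : SimpleGraph V) (n : ℕ) : Prop :=
  ∃ c : V → Fin n, IsDynamicColoring G c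

noncomputable def dynChromNum {V : Type*} (G : SimpleGraph V) : ℕ :=
  sInf {n | DynColorable G n}

noncomputable def chromNum {V : Type*} (G : SimpleGraph V) : ℕ :=
  sInf {n | G.Colorable n}

/-- `G` is `k`-regular: every vertex has exactly `k` neighbors. -/
def IsKRegular {V : Type*} (G : SimpleGraph V) (k : ℕ) : Prop :=
  ∀ v : V, (G.neighborSet v).ncard = k

section Helpers

open Finset

open scoped Classical in
/-- Events of a finite product space that depend on disjoint sets of coordinates are
independent. -/
theorem card_inter_mul_card_eq_of_disjoint_support {V α : Type*} [Fintype V] [Fintype α]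
    (A B : Finset (V → α)) (s : Finset V)
    (hA : ∀ f g : V → α, (∀ x ∈ s, f x = g x) → f ∈ A → g ∈ A)
    (hB : ∀ f g : V → α, (∀ x ∉ s, f x = g x) → f ∈ B → g ∈ B) :
    #(A ∩ B) * Fintype.card (V → α) = #A * #B := by
  rw [← Finset.card_univ, ← card_product, ← card_product]
  refine Finset.card_nbij'
    (fun q => (s.piecewise q.1 q.2, s.piecewise q.2 q.1))
    (fun q => (s.piecewise q.1 q.2, s.piecewise q.2 q.1)) ?_ ?_ ?_ ?_
  · rintro ⟨f, g⟩ h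
    simp only [coe_product, Set.mem_prod, mem_coe, Finset.mem_inter] at h ⊢
    exact ⟨hA f _ (fun x hx => by simp [hx]) h.1.1, hB f _ (fun x hx => by simp [hx]) h.1.2⟩
  · rintro ⟨f, g⟩ h
    simp only [coe_product, Set.mem_prod, mem_coe, Finset.mem_inter] at h ⊢
    exact ⟨⟨hA f _ (fun x hx => by simp [hx]) h.1, hB g _ (fun x hx => by simp [hx]) h.2⟩,
      Finset.mem_univ _⟩
  · rintro ⟨f, g⟩ -
    ext x <;> by_cases hx : x ∈ s <;> simp [hx]
  · rintro ⟨f, g⟩ -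
    ext x <;> by_cases hx : x ∈ s <;> simp [hx]

open scoped Classical in
/-- The symmetric Lovász local lemma on a finite product space with the uniform measure, for
events `B i` depending only on the coordinates in `N i`. -/
theorem exists_forall_notMem_of_local {ι V α : Type*} [Fintype ι] [Fintype V] [Fintype α]
    [Nonempty α] (B : ι → Finset (V → α)) (N : ι → Finset V)
    (hB : ∀ i, ∀ f g : V → α, (∀ x ∈ N i, f x = g x) → f ∈ B i → g ∈ B i)
    (p : ℝ) (d : ℕ) (hp0 : 0 ≤ p) (hp : ∀ i, (#(B i) : ℝ) ≤ p * Fintype.card (V → α))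
    (hd : ∀ i, #{j | ¬ Disjoint (N i) (N j)} ≤ d) (hd1 : 1 ≤ d) (hdp : 4 * d * p ≤ 1) :
    ∃ f : V → α, ∀ i, f ∉ B i := by
  set good : Finset ι → Finset (V → α) := fun T => {f | ∀ i ∈ T, f ∉ B i} with hgood
  have mem_good : ∀ T f, f ∈ good T ↔ ∀ i ∈ T, f ∉ B i := fun T f => by simp [hgood]
  have hΩ : (0 : ℝ) < Fintype.card (V → α) := by exact_mod_cast Fintype.card_pos
  have key : ∀ n : ℕ, ∀ T : Finset ι, #T = n → ∀ i,
      (#(B i ∩ good T) : ℝ) ≤ 2 * p * #(good T) := by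
    intro n
    induction n using Nat.strong_induction_on with
    | _ n ih =>
    intro T hT i
    set T₁ := T.filter (fun j => ¬ Disjoint (N i) (N j)) with hT₁
    set T₂ := T.filter (fun j => Disjoint (N i) (N j)) with hT₂
    have hsub : good T ⊆ good T₂ := fun f hf => by
      rw [mem_good] at hf ⊢
      exact fun j hj => hf j (Finset.mem_filter.1 hj).1
    have hindep : (#(B i ∩ good T₂) : ℝ) ≤ p * #(good T₂) := by
      have h := card_inter_mul_card_eq_of_disjoint_support (B i) (good T₂) (N i) (hB i) (by
        intro f g hfg hf
        rw [mem_good] at hf ⊢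
        intro j hj hgj
        refine hf j hj (hB j g f (fun x hx => (hfg x ?_).symm) hgj)
        exact fun hxi => Finset.disjoint_left.1 (Finset.mem_filter.1 hj).2 hxi hx)
      have h' : (#(B i ∩ good T₂) : ℝ) * Fintype.card (V → α) = #(B i) * #(good T₂) := by
        exact_mod_cast h
      have h2 : (#(B i) : ℝ) * #(good T₂) ≤ p * Fintype.card (V → α) * #(good T₂) :=
        mul_le_mul_of_nonneg_right (hp i) (Nat.cast_nonneg _)
      refine le_of_mul_le_mul_right ?_ hΩ
      linarith
    have hmono : (#(B i ∩ good T) : ℝ) ≤ #(B i ∩ good T₂) := by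
      exact_mod_cast Finset.card_le_card (inter_subset_inter_left hsub)
    have hhalf : (#(good T₂) : ℝ) ≤ 2 * #(good T) := by
      rcases T₁.eq_empty_or_nonempty with h0 | hne
      · have : good T₂ ⊆ good T := fun f hf => by
          rw [mem_good] at hf ⊢
          intro j hj
          refine hf j (Finset.mem_filter.2 ⟨hj, ?_⟩)
          by_contra hc
          have : j ∈ T₁ := Finset.mem_filter.2 ⟨hj, hc⟩
          simp [h0] at this
        have h1 : (#(good T₂) : ℝ) ≤ #(good T) := by exact_mod_cast Finset.card_le_card this
        have h2 : (0 : ℝ) ≤ #(good T) := Nat.cast_nonneg _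
        linarith
      · have hlt : #T₂ < n := by
          have : #T₂ + #T₁ = #T :=
            T.card_filter_add_card_filter_not (fun j => Disjoint (N i) (N j))
          have := hne.card_pos
          omega
        have hcover : good T₂ ⊆ good T ∪ T₁.biUnion (fun j => B j ∩ good T₂) := fun f hf => by
          rw [Finset.mem_union, or_iff_not_imp_left]
          intro hn
          rw [mem_good] at hn
          push Not at hn
          obtain ⟨j, hj, hfj⟩ := hn
          refine Finset.mem_biUnion.2 ⟨j, Finset.mem_filter.2 ⟨hj, fun hdis => ?_⟩,
            Finset.mem_inter.2 ⟨hfj, hf⟩⟩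
          exact (mem_good _ _).1 hf j (Finset.mem_filter.2 ⟨hj, hdis⟩) hfj
        have h1 : (#(good T₂) : ℝ) ≤ #(good T) + ∑ j ∈ T₁, (#(B j ∩ good T₂) : ℝ) := by
          exact_mod_cast (Finset.card_le_card hcover).trans
            ((Finset.card_union_le _ _).trans (Nat.add_le_add_left card_biUnion_le _))
        have h2 : ∑ j ∈ T₁, (#(B j ∩ good T₂) : ℝ) ≤ #T₁ * (2 * p * #(good T₂)) := by
          rw [← nsmul_eq_mul]
          exact sum_le_card_nsmul _ _ _ fun j _ => ih _ hlt T₂ rfl j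
        have h3 : (#T₁ : ℝ) ≤ d := by
          exact_mod_cast (Finset.card_le_card (filter_subset_filter _ (subset_univ T))).trans (hd i)
        have h4 : (#T₁ : ℝ) * (2 * p * #(good T₂)) ≤ d * (2 * p * #(good T₂)) :=
          mul_le_mul_of_nonneg_right h3 (by positivity)
        have h5 : 4 * d * p * #(good T₂) ≤ 1 * #(good T₂) :=
          mul_le_mul_of_nonneg_right hdp (Nat.cast_nonneg _)
        linarith
    have := mul_le_mul_of_nonneg_left hhalf hp0
    linarith
  have hp2 : 4 * p ≤ 1 := by
    have : (1 : ℝ) ≤ d := by exact_mod_cast hd1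
    nlinarith
  have pos : ∀ T : Finset ι, 0 < #(good T) := by
    intro T
    induction T using Finset.induction_on with
    | empty => exact card_pos.2 ⟨fun _ => Classical.arbitrary α, by simp [mem_good]⟩
    | insert i T _ ih =>
      have hcover : good T ⊆ good (insert i T) ∪ (B i ∩ good T) := fun f hf => by
        by_cases hfi : f ∈ B i
        · exact Finset.mem_union_right _ (Finset.mem_inter.2 ⟨hfi, hf⟩)
        · refine Finset.mem_union_left _ ((mem_good _ _).2 ?_)
          rw [mem_good] at hf
          exact Finset.forall_mem_insert .. |>.2 ⟨hfi, hf⟩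
      have h1 : (#(good T) : ℝ) ≤ #(good (insert i T)) + #(B i ∩ good T) := by
        exact_mod_cast (Finset.card_le_card hcover).trans (Finset.card_union_le _ _)
      have h2 := key _ T rfl i
      have h3 : (0 : ℝ) < #(good T) := by exact_mod_cast ih
      have : (0 : ℝ) < #(good (insert i T)) := by nlinarith
      exact_mod_cast this
  obtain ⟨f, hf⟩ := card_pos.1 (pos univ)
  exact ⟨f, fun i => (mem_good _ _).1 hf i (Finset.mem_univ _)⟩

theorem sum_prod_apply_eq {V α : Type*} [Fintype V] [DecidableEq V] [Fintype α] [Nonempty α]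
    (s : Finset V) (w : α → ℝ) :
    ∑ f : V → α, ∏ u ∈ s, w (f u) =
      ((∑ a, w a) / Fintype.card α) ^ #s * Fintype.card (V → α) := by
  have hα : (Fintype.card α : ℝ) ≠ 0 := by exact_mod_cast Fintype.card_ne_zero
  have h := (Finset.prod_univ_sum (fun _ : V => (Finset.univ : Finset α))
    (fun u a => if u ∈ s then w a else 1)).symm
  rw [Fintype.piFinset_univ] at h
  have h1 : ∀ f : V → α, ∏ u ∈ s, w (f u) = ∏ u, if u ∈ s then w (f u) else 1 := fun f => by
    rw [Finset.prod_ite_mem, Finset.univ_inter]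
  simp_rw [h1]
  rw [h]
  have h2 : ∀ u : V, (∑ a : α, if u ∈ s then w a else 1) =
      (if u ∈ s then (∑ a, w a) / Fintype.card α else 1) * Fintype.card α := fun u => by
    split_ifs
    · field_simp
    · simp
  simp_rw [h2]
  rw [Finset.prod_mul_distrib, Finset.prod_ite_mem, Finset.univ_inter]
  simp [div_pow]

/-- A union bound: a random set including each point with probability `1 / N` rarely misses `s`
completely, and rarely meets it in at least `t` points. -/
theorem card_missing_or_crowded_le {V : Type*} [Fintype V] [DecidableEq V] (N t : ℕ) [NeZero N]
    (s : Finset V) :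
    (#{f : V → Fin N | #{u ∈ s | f u = 0} = 0 ∨ t ≤ #{u ∈ s | f u = 0}} : ℝ) ≤
      ((1 - 1 / N) ^ #s + (1 + 1 / N) ^ #s / 2 ^ t) * Fintype.card (V → Fin N) := by
  have hN : (N : ℝ) ≠ 0 := by exact_mod_cast NeZero.ne N
  have e0 := sum_prod_apply_eq s (fun a : Fin N => if a = 0 then (0 : ℝ) else 1)
  have e1 := sum_prod_apply_eq s (fun a : Fin N => if a = 0 then (2 : ℝ) else 1)
  have s0 : (∑ a : Fin N, if a = 0 then (0 : ℝ) else 1) = N - 1 := by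
    have : ∀ a : Fin N, (if a = 0 then (0 : ℝ) else 1) = 1 - if a = 0 then 1 else 0 := fun a => by
      split_ifs <;> norm_num
    simp_rw [this]
    simp
  have s1 : (∑ a : Fin N, if a = 0 then (2 : ℝ) else 1) = N + 1 := by
    have : ∀ a : Fin N, (if a = 0 then (2 : ℝ) else 1) = 1 + if a = 0 then 1 else 0 := fun a => by
      split_ifs <;> norm_num
    simp_rw [this, Finset.sum_add_distrib]
    simp
  rw [s0, Fintype.card_fin, sub_div, div_self hN] at e0
  rw [s1, Fintype.card_fin, add_div, div_self hN] at e1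
  rw [add_mul, div_mul_eq_mul_div, ← e0, ← e1, Finset.sum_div, ← Finset.sum_add_distrib,
    Finset.card_filter, Nat.cast_sum]
  refine Finset.sum_le_sum fun f _ => ?_
  have p1 : ∏ u ∈ s, (if f u = 0 then (2 : ℝ) else 1) = 2 ^ #{u ∈ s | f u = 0} := by
    rw [Finset.prod_ite]
    simp
  have p0 : 0 ≤ ∏ u ∈ s, (if f u = 0 then (0 : ℝ) else 1) :=
    Finset.prod_nonneg fun u _ => by split_ifs <;> norm_num
  rw [p1]
  split_ifs with h
  · rcases h with h | h
    · have : ∏ u ∈ s, (if f u = 0 then (0 : ℝ) else 1) = 1 := by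
        refine Finset.prod_eq_one fun u hu => if_neg fun hfu => ?_
        rw [Finset.card_eq_zero] at h
        exact Finset.notMem_empty u (h ▸ Finset.mem_filter.2 ⟨hu, hfu⟩)
      rw [this]
      simp only [Nat.cast_one, le_add_iff_nonneg_right]
      positivity
    · have : (1 : ℝ) ≤ 2 ^ #{u ∈ s | f u = 0} / 2 ^ t := by
        rw [one_le_div (by positivity)]
        exact pow_le_pow_right₀ (by norm_num) h
      simp only [Nat.cast_one]
      linarith
  · simp only [Nat.cast_zero]
    positivity

theorem colorable_of_forall_ncard_neighborSet_lt {V : Type*} [Finite V] (G : SimpleGraph V)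
    (d : ℕ) (h : ∀ v, (G.neighborSet v).ncard < d) : G.Colorable d := by
  classical
  have := Fintype.ofFinite V
  have key : ∀ s : Finset V, ∃ c : V → Fin d, ∀ u ∈ s, ∀ v ∈ s, G.Adj u v → c u ≠ c v := by
    intro s
    induction s using Finset.induction_on with
    | empty => exact ⟨fun v => ⟨0, (Nat.zero_le _).trans_lt (h v)⟩, by simp⟩
    | insert a s ha ih =>
      obtain ⟨c, hc⟩ := ih
      have hcard : #((G.neighborFinset a).image c) < #(Finset.univ : Finset (Fin d)) := by
        rw [Finset.card_fin]
        refine Finset.card_image_le.trans_lt ?_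
        have := h a
        rwa [Set.ncard_eq_toFinset_card'] at this
      obtain ⟨x, -, hx⟩ := Finset.exists_mem_notMem_of_card_lt_card hcard
      have hx' : ∀ v, G.Adj a v → x ≠ c v := fun v hv hxv =>
        hx (Finset.mem_image.2 ⟨v, by simpa using hv, hxv.symm⟩)
      refine ⟨Function.update c a x, fun u hu v hv huv => ?_⟩
      rcases eq_or_ne u a with rfl | hua
      · rw [Function.update_self, Function.update_of_ne huv.ne']
        exact hx' v huv
      · rcases eq_or_ne v a with rfl | hva
        · rw [Function.update_self, Function.update_of_ne hua]
          exact (hx' u huv.symm).symm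
        · rw [Function.update_of_ne hua, Function.update_of_ne hva]
          exact hc u (Finset.mem_of_mem_insert_of_ne hu hua) v
            (Finset.mem_of_mem_insert_of_ne hv hva) huv
  obtain ⟨c, hc⟩ := key Finset.univ
  exact ⟨SimpleGraph.Coloring.mk c fun {u v} huv =>
    hc u (Finset.mem_univ _) v (Finset.mem_univ _) huv⟩

theorem colorable_chromNum {V : Type*} [Finite V] (G : SimpleGraph V) :
    G.Colorable (chromNum G) := by
  have := Fintype.ofFinite V
  exact Nat.sInf_mem (s := {n | G.Colorable n}) ⟨_, G.colorable_of_fintype⟩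

/-- Color a set `S` meeting every neighborhood, but containing none, with fresh colors. -/
theorem DynColorable.of_induce {V : Type*} (G : SimpleGraph V) (S : Set V) {m t : ℕ}
    (hG : G.Colorable m) (hS : (G.induce S).Colorable t)
    (hin : ∀ v, ∃ u ∈ G.neighborSet v, u ∈ S) (hout : ∀ v, ∃ u ∈ G.neighborSet v, u ∉ S) :
    DynColorable G (m + t) := by
  classical
  obtain ⟨c₁⟩ := hG
  obtain ⟨c₂⟩ := hS
  refine ⟨fun v => if hv : v ∈ S then Fin.natAdd m (c₂ ⟨v, hv⟩) else Fin.castAdd t (c₁ v), ?_, ?_⟩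
  · intro u v huv
    by_cases hu : u ∈ S <;> by_cases hv : v ∈ S <;> simp only [hu, hv, dite_true, dite_false]
    · rw [Ne, Fin.natAdd_inj]
      exact c₂.valid (v := ⟨u, hu⟩) (w := ⟨v, hv⟩) huv
    · simp only [ne_eq, Fin.ext_iff, Fin.val_natAdd, Fin.val_castAdd]
      omega
    · simp only [ne_eq, Fin.ext_iff, Fin.val_natAdd, Fin.val_castAdd]
      omega
    · rw [Ne, Fin.castAdd_inj]
      exact c₁.valid huv
  · intro v _
    obtain ⟨u, hu, huS⟩ := hin v
    obtain ⟨w, hw, hwS⟩ := hout v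
    refine ⟨u, w, hu, hw, ?_⟩
    simp only [huS, hwS, dite_true, dite_false, ne_eq, Fin.ext_iff, Fin.val_natAdd,
      Fin.val_castAdd]
    omega

theorem DynColorable.of_isKRegular {V : Type*} [Finite V] (G : SimpleGraph V) (k : ℕ)
    (hG : IsKRegular G k) : DynColorable G (k + k * k + 1) := by
  classical
  have := Fintype.ofFinite V
  have hdeg : ∀ v, #(G.neighborFinset v) = k := fun v => by
    rw [← hG v, Set.ncard_eq_toFinset_card', SimpleGraph.neighborFinset]
  let H : SimpleGraph V := SimpleGraph.fromRel fun u v => G.Adj u v ∨ ∃ w, G.Adj u w ∧ G.Adj w v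
  have hH : H.Colorable (k + k * k + 1) := by
    refine colorable_of_forall_ncard_neighborSet_lt H _ fun v => Nat.lt_succ_of_le ?_
    have hsub : H.neighborSet v ⊆
        (G.neighborFinset v ∪
          (G.neighborFinset v).biUnion fun w => G.neighborFinset w : Finset V) := by
      intro u hu
      simp only [SimpleGraph.mem_neighborSet, H, SimpleGraph.fromRel_adj] at hu
      simp only [Finset.coe_union, Set.mem_union, Finset.mem_coe, Finset.mem_biUnion,
        SimpleGraph.mem_neighborFinset]
      obtain ⟨-, (h | ⟨w, h₁, h₂⟩) | (h | ⟨w, h₁, h₂⟩)⟩ := hu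
      · exact Or.inl h
      · exact Or.inr ⟨w, h₁, h₂⟩
      · exact Or.inl h.symm
      · exact Or.inr ⟨w, h₂.symm, h₁.symm⟩
    refine (Set.ncard_le_ncard hsub (Finset.finite_toSet _)).trans ?_
    rw [Set.ncard_coe_finset]
    refine (Finset.card_union_le _ _).trans (add_le_add (hdeg v).le ?_)
    refine (Finset.card_biUnion_le_card_mul _ _ k fun w _ => (hdeg w).le).trans ?_
    rw [hdeg]
  obtain ⟨c⟩ := hH
  refine ⟨c, fun u v huv => c.valid ?_, fun v hv => ?_⟩
  · exact (SimpleGraph.fromRel_adj _ _ _).2 ⟨huv.ne, Or.inl (Or.inl huv)⟩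
  · obtain ⟨u, hu, w, hw, huw⟩ := (Set.one_lt_ncard (Set.toFinite _)).1 hv
    exact ⟨u, w, hu, hw, c.valid
      ((SimpleGraph.fromRel_adj _ _ _).2 ⟨huw, Or.inl (Or.inr ⟨v, hu.symm, hw⟩)⟩)⟩

open scoped Classical in
theorem exists_set_of_isKRegular {V : Type*} [Fintype V] (G : SimpleGraph V) (k N t : ℕ)
    [NeZero N] (hk : 1 ≤ k) (hG : IsKRegular G k)
    (hp : 4 * (k * k : ℕ) * ((1 - 1 / N) ^ k + (1 + 1 / N) ^ k / 2 ^ t : ℝ) ≤ 1) :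
    ∃ S : Set V, ∀ v, 0 < (G.neighborSet v ∩ S).ncard ∧ (G.neighborSet v ∩ S).ncard < t := by
  have hdeg : ∀ v, #(G.neighborFinset v) = k := fun v => by
    rw [← hG v, Set.ncard_eq_toFinset_card', SimpleGraph.neighborFinset]
  have hN : (1 : ℝ) ≤ N := by exact_mod_cast NeZero.one_le
  have hN' : (0 : ℝ) ≤ 1 - 1 / N := by
    rw [sub_nonneg, div_le_one (by linarith)]
    exact hN
  obtain ⟨f, hf⟩ := exists_forall_notMem_of_local
    (fun v => ({f : V → Fin N | #{u ∈ G.neighborFinset v | f u = 0} = 0 ∨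
      t ≤ #{u ∈ G.neighborFinset v | f u = 0}} : Finset _))
    (fun v => G.neighborFinset v)
    (by
      intro v f g hfg
      have : ({u ∈ G.neighborFinset v | f u = 0} : Finset V) =
          {u ∈ G.neighborFinset v | g u = 0} :=
        Finset.filter_congr fun u hu => by simp only [hfg u hu]
      simp only [Finset.mem_filter, Finset.mem_univ, true_and, this]
      exact id)
    ((1 - 1 / N) ^ k + (1 + 1 / N) ^ k / 2 ^ t : ℝ) (k * k) (by positivity)
    (fun v => by
      have := card_missing_or_crowded_le N t (G.neighborFinset v)
      rw [hdeg] at this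
      convert this)
    (fun v => by
      have hsub : (Finset.univ.filter
          fun u => ¬ Disjoint (G.neighborFinset v) (G.neighborFinset u)) ⊆
          (G.neighborFinset v).biUnion fun w => G.neighborFinset w := fun u hu => by
        obtain ⟨w, h₁, h₂⟩ := Finset.not_disjoint_iff.1 (Finset.mem_filter.1 hu).2
        refine Finset.mem_biUnion.2 ⟨w, h₁, ?_⟩
        rw [SimpleGraph.mem_neighborFinset] at h₂ ⊢
        exact h₂.symm
      refine (Finset.card_le_card hsub).trans
        ((Finset.card_biUnion_le_card_mul _ _ k fun w _ => (hdeg w).le).trans ?_)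
      rw [hdeg])
    (Nat.mul_pos hk hk) hp
  refine ⟨{u | f u = 0}, fun v => ?_⟩
  have h := hf v
  have hcard : (G.neighborSet v ∩ {u | f u = 0}).ncard =
      #{u ∈ G.neighborFinset v | f u = 0} := by
    rw [← Set.ncard_coe_finset]
    congr 1
    ext u
    simp
  rw [hcard]
  simp only [Finset.mem_filter, Finset.mem_univ, true_and, not_or, not_le] at h
  exact ⟨Nat.pos_of_ne_zero h.1, h.2⟩

theorem DynColorable.of_exists_set {V : Type*} [Finite V] (G : SimpleGraph V) (k t : ℕ)
    (hG : IsKRegular G k) (htk : t ≤ k) (S : Set V)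
    (hS : ∀ v, 0 < (G.neighborSet v ∩ S).ncard ∧ (G.neighborSet v ∩ S).ncard < t) :
    DynColorable G (chromNum G + t) := by
  refine DynColorable.of_induce G S (colorable_chromNum G) ?_ ?_ ?_
  · refine colorable_of_forall_ncard_neighborSet_lt _ t fun v => ?_
    rw [← Set.ncard_image_of_injective _ Subtype.val_injective]
    refine (Set.ncard_le_ncard ?_ (Set.toFinite _)).trans_lt (hS v).2
    rintro _ ⟨u, hu, rfl⟩
    exact ⟨hu, u.2⟩
  · exact fun v => (Set.ncard_pos (Set.toFinite _)).1 (hS v).1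
  · intro v
    by_contra! hc
    have : G.neighborSet v ∩ S = G.neighborSet v := Set.inter_eq_left.2 hc
    have h2 := (hS v).2
    rw [this, hG v] at h2
    omega

/-- The quantitative estimate feeding the local lemma, with `N ≈ k / (4 log k)` and
`t = ⌈20 log k⌉`. -/
theorem exists_parameters (k : ℕ) (hk : 2000 ≤ k) :
    ⌈20 * Real.log k⌉₊ ≤ k ∧ ∃ N : ℕ, N ≠ 0 ∧
      4 * (k * k : ℕ) *
        ((1 - 1 / N) ^ k + (1 + 1 / N) ^ k / 2 ^ ⌈20 * Real.log k⌉₊ : ℝ) ≤ 1 := by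
  have hk' : (2000 : ℝ) ≤ k := by exact_mod_cast hk
  have hk0 : (0 : ℝ) < k := by linarith
  set L := Real.log k with hL
  have hL1 : 1 ≤ L := by
    rw [hL, Real.le_log_iff_exp_le hk0]
    linarith [Real.exp_one_lt_d9]
  have hexpL : Real.exp L = k := Real.exp_log hk0
  have hLk : 20 * L ≤ k := by
    have h1 : L = 2 * Real.log √k := by rw [Real.log_sqrt hk0.le]; ring
    have h2 := Real.log_le_sub_one_of_pos (Real.sqrt_pos.2 hk0)
    have h3 : (40 : ℝ) ≤ √k := Real.le_sqrt_of_sq_le (by linarith)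
    have h4 := Real.mul_self_sqrt hk0.le
    nlinarith
  refine ⟨Nat.ceil_le.2 hLk, ⌊k / (4 * L)⌋₊, ?_⟩
  set N := ⌊k / (4 * L)⌋₊ with hN
  have hge : 1 ≤ k / (4 * L) := by
    rw [one_le_div (by linarith)]
    linarith
  have hN1 : 1 ≤ N := Nat.le_floor (by exact_mod_cast hge)
  have hN1' : (1 : ℝ) ≤ N := by exact_mod_cast hN1
  have hNle : (N : ℝ) ≤ k / (4 * L) := Nat.floor_le (by positivity)
  have hNlt : k / (4 * L) < N + 1 := Nat.lt_floor_add_one _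
  refine ⟨by omega, ?_⟩
  have hlow : 4 * L ≤ k / N := by
    rw [le_div_iff₀ (by linarith : (0 : ℝ) < 4 * L)] at hNle
    rw [le_div_iff₀ (by linarith)]
    linarith
  have hhigh : k / N ≤ 8 * L := by
    rw [div_lt_iff₀ (by linarith)] at hNlt
    rw [div_le_iff₀ (by linarith)]
    nlinarith
  have hA : (1 - 1 / N : ℝ) ^ k ≤ Real.exp (-(4 * L)) := by
    have h1 : (1 - 1 / N : ℝ) ≤ Real.exp (-(1 / N)) := by
      linarith [Real.add_one_le_exp (-(1 / N : ℝ))]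
    have h0 : (0 : ℝ) ≤ 1 - 1 / N := by
      rw [sub_nonneg, div_le_one (by linarith)]
      exact hN1'
    refine (pow_le_pow_left₀ h0 h1 k).trans ?_
    rw [← Real.exp_nat_mul, Real.exp_le_exp]
    have : (k : ℝ) * -(1 / N) = -(k / N) := by ring
    linarith
  have hB : (1 + 1 / N : ℝ) ^ k ≤ Real.exp (8 * L) := by
    have h1 : (1 + 1 / N : ℝ) ≤ Real.exp (1 / N) := by
      linarith [Real.add_one_le_exp (1 / N : ℝ)]
    refine (pow_le_pow_left₀ (by positivity) h1 k).trans ?_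
    rw [← Real.exp_nat_mul, Real.exp_le_exp]
    have : (k : ℝ) * (1 / N) = k / N := by ring
    linarith
  have hC : Real.exp (12 * L) ≤ 2 ^ ⌈20 * L⌉₊ := by
    rw [← Real.exp_log (two_pos : (0 : ℝ) < 2), ← Real.exp_nat_mul, Real.exp_le_exp]
    have h1 := Nat.le_ceil (20 * L)
    have h2 := Real.log_two_gt_d9
    nlinarith
  have hD : (1 + 1 / N : ℝ) ^ k / 2 ^ ⌈20 * L⌉₊ ≤ Real.exp (-(4 * L)) := by
    rw [div_le_iff₀ (by positivity)]
    calc (1 + 1 / N : ℝ) ^ k ≤ Real.exp (8 * L) := hB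
      _ = Real.exp (-(4 * L)) * Real.exp (12 * L) := by rw [← Real.exp_add]; ring_nf
      _ ≤ _ := mul_le_mul_of_nonneg_left hC (Real.exp_nonneg _)
  have hE : Real.exp (-(4 * L)) = 1 / (k : ℝ) ^ 4 := by
    rw [Real.exp_neg, ← hexpL, ← Real.exp_nat_mul, one_div]
    norm_num
  rw [hE] at hA hD
  calc 4 * ((k * k : ℕ) : ℝ) * ((1 - 1 / N) ^ k + (1 + 1 / N) ^ k / 2 ^ ⌈20 * L⌉₊ : ℝ)
      ≤ 4 * ((k * k : ℕ) : ℝ) * (1 / (k : ℝ) ^ 4 + 1 / (k : ℝ) ^ 4) :=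
        mul_le_mul_of_nonneg_left (add_le_add hA hD) (by positivity)
    _ = 8 / (k : ℝ) ^ 2 := by push_cast; field_simp; norm_num
    _ ≤ 1 := by
      rw [div_le_one (by positivity)]
      nlinarith

end Helpers

/-- There is a constant `c > 0` such that every finite `k`-regular graph `G` satisfies
`χ_d(G) ≤ χ(G) + c · ln k + 1`. -/
theorem dynChromNum_le_chromNum_add_log :
    ∃ c : ℝ, 0 < c ∧ ∀ (k : ℕ), 1 ≤ k → ∀ (V : Type) [Fintype V] (G : SimpleGraph V),
      IsKRegular G k →
        (dynChromNum G : ℝ) ≤ (chromNum G : ℝ) + c * Real.log k + 1 := by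
  refine ⟨10 ^ 7, by norm_num, fun k hk V _ G hG => ?_⟩
  have hlog : 0 ≤ Real.log k := Real.log_natCast_nonneg k
  rcases hk.eq_or_lt with rfl | hk2
  · have h : dynChromNum G ≤ chromNum G := by
      obtain ⟨c⟩ := colorable_chromNum G
      refine Nat.sInf_le ⟨c, fun u v huv => c.valid huv, fun v hv => ?_⟩
      have := hG v
      omega
    have h' : (dynChromNum G : ℝ) ≤ chromNum G := by exact_mod_cast h
    linarith
  rcases lt_or_ge k 2000 with hsmall | hbig
  · have h : dynChromNum G ≤ k + k * k + 1 := Nat.sInf_le (DynColorable.of_isKRegular G k hG)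
    have h' : (dynChromNum G : ℝ) ≤ k + k * k + 1 := by exact_mod_cast h
    have hk1 : (k : ℝ) ≤ 2000 := by exact_mod_cast hsmall.le
    have hk0 : (2 : ℝ) ≤ k := by exact_mod_cast hk2
    have h2 : Real.log 2 ≤ Real.log k := Real.log_le_log (by norm_num) hk0
    have h3 := Real.log_two_gt_d9
    have h4 : (0 : ℝ) ≤ chromNum G := Nat.cast_nonneg _
    nlinarith
  · obtain ⟨htk, N, hN, hp⟩ := exists_parameters k hbig
    have : NeZero N := ⟨hN⟩
    obtain ⟨S, hS⟩ := exists_set_of_isKRegular G k N _ hk hG hp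
    have h : dynChromNum G ≤ chromNum G + ⌈20 * Real.log k⌉₊ :=
      Nat.sInf_le (DynColorable.of_exists_set G k _ hG htk S hS)
    have h' : (dynChromNum G : ℝ) ≤ chromNum G + (⌈20 * Real.log k⌉₊ : ℝ) := by exact_mod_cast h
    have h2 := Nat.ceil_lt_add_one (mul_nonneg (by norm_num : (0 : ℝ) ≤ 20) hlog)
    linarith
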